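/- arXiv:2308.16189 — 2 statements merged into one kernel-verified Lean document; each statement's English description precedes it below -/
import Mathlib

section
/- Let 0 < ρ < 1 and λ ∈ ℂ. Then for every t > 0 the Caputo derivative of order ρ of the function t ↦ E_{ρ,1}(λ t^ρ) equals λ E_{ρ,1}(λ t^ρ), i.e. D_t^ρ E_{ρ,1}(λ t^ρ) = λ E_{ρ,1}(λ t^ρ). -/
open intervalIntegral

/-- The two-parameter Mittag-Leffler function `E_{ρ,μ}(z) = ∑_{k=0}^∞ z^k / Γ(ρk + μ)`. -/
noncomputable def mittagLeffler (ρ : ℝ) (μ : ℂ) (z : ℂ) : ℂ :=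
  ∑' k : ℕ, z ^ k / Complex.Gamma ((ρ : ℂ) * k + μ)

/-- The Caputo fractional derivative of order `ρ ∈ (0,1)`:
`D_t^ρ h(t) = (1/Γ(1-ρ)) ∫_0^t (t-ξ)^(-ρ) h'(ξ) dξ`. -/
noncomputable def caputoDeriv {E : Type*} [NormedAddCommGroup E] [NormedSpace ℝ E]
    (ρ : ℝ) (h : ℝ → E) (t : ℝ) : E :=
  (1 / Real.Gamma (1 - ρ)) • ∫ ξ in (0:ℝ)..t, ((t - ξ) ^ (-ρ) : ℝ) • deriv h ξ

open MeasureTheory Set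

/-- Cutting Euler's integral off at `A` bounds the Gamma function below by any exponential. -/
lemma rpow_mul_exp_neg_le_Gamma_add_one {A s : ℝ} (hA : 0 < A) (hs : 0 ≤ s) :
    A ^ s * Real.exp (-A) ≤ Real.Gamma (s + 1) := by
  have hint : IntegrableOn (fun x : ℝ => Real.exp (-x) * x ^ s) (Ioi 0) := by
    simpa using Real.GammaIntegral_convergent (s := s + 1) (by linarith)
  rw [Real.Gamma_eq_integral (by linarith)]
  simp only [add_sub_cancel_right]
  calc A ^ s * Real.exp (-A) = ∫ x in Ioi A, A ^ s * Real.exp (-x) := by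
        rw [MeasureTheory.integral_const_mul, integral_exp_neg_Ioi]
    _ ≤ ∫ x in Ioi A, Real.exp (-x) * x ^ s := by
        refine setIntegral_mono_on ((integrableOn_exp_neg_Ioi A).const_mul _)
          (hint.mono_set (Ioi_subset_Ioi hA.le)) measurableSet_Ioi fun x hx => ?_
        rw [mul_comm]
        gcongr
        exact (mem_Ioi.mp hx).le
    _ ≤ ∫ x in Ioi 0, Real.exp (-x) * x ^ s := by
        refine setIntegral_mono_set hint ?_ (Ioi_subset_Ioi hA.le).eventuallyLE
        filter_upwards [ae_restrict_mem measurableSet_Ioi] with x hx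
        have : 0 < x := hx
        positivity

lemma summable_pow_div_Gamma {ρ : ℝ} (hρ : 0 < ρ) {x : ℝ} (hx : 0 ≤ x) :
    Summable fun k : ℕ => x ^ k / Real.Gamma (ρ * k + 1) := by
  set A : ℝ := (2 * x + 1) ^ ρ⁻¹ with hAdef
  have hA : 0 < A := by positivity
  have hAρ : A ^ ρ = 2 * x + 1 := by
    rw [hAdef, ← Real.rpow_mul (by positivity), inv_mul_cancel₀ hρ.ne', Real.rpow_one]
  have hgeom : Summable fun k : ℕ => Real.exp A * (x / (2 * x + 1)) ^ k :=
    (summable_geometric_of_lt_one (by positivity)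
      ((div_lt_one (by positivity)).2 (by linarith))).mul_left _
  refine hgeom.of_nonneg_of_le (fun k => ?_) (fun k => ?_)
  · have := Real.Gamma_pos_of_pos (s := ρ * k + 1) (by positivity)
    positivity
  · have h := rpow_mul_exp_neg_le_Gamma_add_one hA (s := ρ * k) (by positivity)
    rw [Real.rpow_mul hA.le, hAρ, Real.rpow_natCast, Real.exp_neg] at h
    calc x ^ k / Real.Gamma (ρ * k + 1)
        ≤ x ^ k / ((2 * x + 1) ^ k * (Real.exp A)⁻¹) := by gcongr
      _ = _ := by rw [div_pow]; field_simp

lemma summable_mul_pow_div_Gamma {ρ : ℝ} (hρ : 0 < ρ) {x : ℝ} (hx : 0 < x) :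
    Summable fun k : ℕ => k * x ^ (k - 1) / Real.Gamma (ρ * k + 1) := by
  refine ((summable_pow_div_Gamma hρ (x := 2 * x) (by positivity)).mul_left x⁻¹).of_nonneg_of_le
    (fun k => ?_) (fun k => ?_)
  · have := Real.Gamma_pos_of_pos (s := ρ * k + 1) (by positivity)
    positivity
  · have := Real.Gamma_pos_of_pos (s := ρ * k + 1) (by positivity)
    rw [← mul_div_assoc]
    refine div_le_div_of_nonneg_right ?_ this.le
    rcases k with _ | k
    · simp [hx.le]
    · have h2 : ((k + 1 : ℕ) : ℝ) ≤ 2 ^ (k + 1) := by exact_mod_cast Nat.lt_two_pow_self.le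
      calc ((k + 1 : ℕ) : ℝ) * x ^ (k + 1 - 1) ≤ 2 ^ (k + 1) * x ^ k := by
            rw [Nat.add_sub_cancel]; gcongr
        _ = _ := by rw [mul_pow, pow_succ x]; field_simp

lemma hasDerivAt_mittagLeffler_one {ρ : ℝ} (hρ : 0 < ρ) (z : ℂ) :
    HasDerivAt (mittagLeffler ρ 1)
      (∑' k : ℕ, k * z ^ (k - 1) / (Real.Gamma (ρ * k + 1) : ℂ)) z := by
  have hG : ∀ k : ℕ, Complex.Gamma ((ρ : ℂ) * k + 1) = (Real.Gamma (ρ * k + 1) : ℂ) := fun k => by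
    rw [← Complex.Gamma_ofReal]; push_cast; rfl
  have hE : mittagLeffler ρ 1 = fun z => ∑' k : ℕ, z ^ k / (Real.Gamma (ρ * k + 1) : ℂ) := by
    funext z; simp only [mittagLeffler, hG]
  rw [hE]
  have hR : 0 < ‖z‖ + 1 := by positivity
  refine hasDerivAt_tsum_of_isPreconnected (summable_mul_pow_div_Gamma hρ hR)
    Metric.isOpen_ball (convex_ball (0 : ℂ) (‖z‖ + 1)).isPreconnected
    (fun k y _ => (hasDerivAt_pow k y).div_const _) (fun k y hy => ?_)
    (Metric.mem_ball_self hR) ?_ (by simp)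
  · have hΓ := Real.Gamma_pos_of_pos (s := ρ * k + 1) (by positivity)
    rw [norm_div, norm_mul, norm_pow, Complex.norm_natCast, Complex.norm_of_nonneg hΓ.le]
    gcongr
    simpa using (mem_ball_zero_iff.1 hy).le
  · refine (hasSum_single 0 fun k hk => ?_).summable
    simp [hk]

lemma integral_sub_rpow_mul_rpow {a b t : ℝ} (ha : 0 < a) (hb : 0 < b) (ht : 0 < t) :
    ∫ x in (0 : ℝ)..t, (t - x) ^ (a - 1) * x ^ (b - 1)
      = t ^ (a + b - 1) * (Real.Gamma a * Real.Gamma b / Real.Gamma (a + b)) := by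
  have h := Complex.betaIntegral_scaled b a ht
  rw [Complex.betaIntegral_eq_Gamma_mul_div _ _ (by simpa) (by simpa)] at h
  apply Complex.ofReal_injective
  rw [← intervalIntegral.integral_ofReal]
  convert h using 1
  · refine intervalIntegral.integral_congr fun x hx => ?_
    rw [uIcc_of_le ht.le] at hx
    have h1 := Complex.ofReal_cpow (sub_nonneg.2 hx.2) (a - 1)
    have h2 := Complex.ofReal_cpow hx.1 (b - 1)
    push_cast at h1 h2 ⊢
    rw [h1, h2, mul_comm]
  · have h1 := Complex.ofReal_cpow ht.le (a + b - 1)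
    push_cast at h1 ⊢
    rw [h1, ← Complex.Gamma_ofReal, ← Complex.Gamma_ofReal, ← Complex.Gamma_ofReal,
      add_comm (b : ℂ) a, mul_comm (Complex.Gamma b)]
    push_cast
    rfl

lemma integrableOn_sub_rpow_mul_rpow {a b t : ℝ} (ha : 0 < a) (hb : 0 < b) (ht : 0 < t) :
    IntegrableOn (fun x : ℝ => (t - x) ^ (a - 1) * x ^ (b - 1)) (Ioc 0 t) := by
  by_contra hcon
  have h := integral_sub_rpow_mul_rpow ha hb ht
  rw [intervalIntegral.integral_of_le ht.le, integral_undef hcon] at h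
  have h1 := Real.Gamma_pos_of_pos ha
  have h2 := Real.Gamma_pos_of_pos hb
  have h3 := Real.Gamma_pos_of_pos (add_pos ha hb)
  have : 0 < t ^ (a + b - 1) * (Real.Gamma a * Real.Gamma b / Real.Gamma (a + b)) := by positivity
  exact this.ne h

lemma deriv_mittagLeffler_mul_rpow {ρ : ℝ} (hρ : 0 < ρ) (lam : ℂ) {s : ℝ} (hs : 0 < s) :
    deriv (fun s : ℝ => mittagLeffler ρ 1 (lam * ((s ^ ρ : ℝ) : ℂ))) s
      = ∑' k : ℕ, (s ^ (ρ * (k + 1) - 1) : ℝ) •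
          (lam ^ (k + 1) / (Real.Gamma (ρ * (k + 1)) : ℂ)) := by
  have h1 : HasDerivAt (fun s : ℝ => lam * ((s ^ ρ : ℝ) : ℂ))
      (lam * ((ρ * s ^ (ρ - 1) : ℝ) : ℂ)) s :=
    ((Real.hasDerivAt_rpow_const (Or.inl hs.ne')).ofReal_comp).const_mul lam
  have h2 := (hasDerivAt_mittagLeffler_one hρ (lam * ((s ^ ρ : ℝ) : ℂ))).comp s h1
  rw [show (fun s : ℝ => mittagLeffler ρ 1 (lam * ((s ^ ρ : ℝ) : ℂ)))
    = mittagLeffler ρ 1 ∘ fun s : ℝ => lam * ((s ^ ρ : ℝ) : ℂ) from rfl, h2.deriv,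
    ← tsum_mul_right]
  rw [← Nat.succ_injective.tsum_eq]
  · refine tsum_congr fun k => ?_
    have hpos : 0 < ρ * (k + 1) := by positivity
    have hΓ : (Real.Gamma (ρ * (k + 1)) : ℂ) ≠ 0 := by
      exact_mod_cast (Real.Gamma_pos_of_pos hpos).ne'
    have hρ' : (ρ : ℂ) ≠ 0 := by exact_mod_cast hρ.ne'
    have hk : (k : ℂ) + 1 ≠ 0 := by exact_mod_cast k.succ_ne_zero
    have hpow : s ^ (ρ * (k + 1) - 1) = (s ^ ρ) ^ k * s ^ (ρ - 1) := by
      rw [← Real.rpow_natCast, ← Real.rpow_mul hs.le, ← Real.rpow_add hs]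
      ring_nf
    simp only [Nat.succ_eq_add_one, Nat.add_sub_cancel, Nat.cast_add, Nat.cast_one]
    rw [Real.Gamma_add_one hpos.ne', hpow, Complex.real_smul]
    push_cast
    field_simp
    ring
  · intro k hk
    rcases k with _ | k
    · simp at hk
    · exact ⟨k, rfl⟩

/-- **Lemma 3.4, first identity**: for `0 < ρ < 1`, `λ ∈ ℂ` and `t > 0`,
`D_t^ρ E_{ρ,1}(λ t^ρ) = λ E_{ρ,1}(λ t^ρ)`. -/
theorem caputoDeriv_mittagLeffler (ρ : ℝ) (hρ0 : 0 < ρ) (hρ1 : ρ < 1) (lam : ℂ)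
    (t : ℝ) (ht : 0 < t) :
    caputoDeriv ρ (fun s => mittagLeffler ρ 1 (lam * ((s ^ ρ : ℝ) : ℂ))) t
      = lam * mittagLeffler ρ 1 (lam * ((t ^ ρ : ℝ) : ℂ)) := by
  have ha : 0 < 1 - ρ := by linarith
  have hΓa := Real.Gamma_pos_of_pos ha
  have hb : ∀ k : ℕ, 0 < ρ * (k + 1) := fun k => by positivity
  have hΓb := fun k => Real.Gamma_pos_of_pos (hb k)
  have hΓ : ∀ k : ℕ, 0 < Real.Gamma (ρ * k + 1) := fun k => Real.Gamma_pos_of_pos (by positivity)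
  let c : ℕ → ℂ := fun k => lam ^ (k + 1) / (Real.Gamma (ρ * (k + 1)) : ℂ)
  let w : ℕ → ℝ → ℝ := fun k ξ => (t - ξ) ^ (-ρ) * ξ ^ (ρ * (k + 1) - 1)
  have hexp : 1 - ρ - 1 = -ρ := by ring
  have hw : ∀ k, IntegrableOn (w k) (Ioc 0 t) := fun k => by
    simpa only [hexp] using integrableOn_sub_rpow_mul_rpow ha (hb k) ht
  have hwI : ∀ k, ∫ ξ in Ioc 0 t, w k ξ = (t ^ ρ) ^ k *
      (Real.Gamma (1 - ρ) * Real.Gamma (ρ * (k + 1)) / Real.Gamma (ρ * k + 1)) := fun k => by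
    have h := integral_sub_rpow_mul_rpow ha (hb k) ht
    rw [hexp, intervalIntegral.integral_of_le ht.le] at h
    rw [h, ← Real.rpow_natCast, ← Real.rpow_mul ht.le]
    ring_nf
  have hnorm : ∀ k, ∫ ξ in Ioc 0 t, ‖w k ξ • c k‖
      = Real.Gamma (1 - ρ) * ‖lam‖ * ((‖lam‖ * t ^ ρ) ^ k / Real.Gamma (ρ * k + 1)) := fun k => by
    have hc : ‖c k‖ = ‖lam‖ ^ (k + 1) / Real.Gamma (ρ * (k + 1)) := by
      simp only [c]
      rw [norm_div, norm_pow, Complex.norm_of_nonneg (hΓb k).le]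
    calc ∫ ξ in Ioc 0 t, ‖w k ξ • c k‖ = ∫ ξ in Ioc 0 t, w k ξ * ‖c k‖ := by
          refine setIntegral_congr_fun measurableSet_Ioc fun ξ hξ => ?_
          have h0 : 0 ≤ w k ξ :=
            mul_nonneg (Real.rpow_nonneg (sub_nonneg.2 hξ.2) _) (Real.rpow_nonneg hξ.1.le _)
          simp only [norm_smul, Real.norm_of_nonneg h0]
      _ = _ := by
          rw [MeasureTheory.integral_mul_const, hwI, hc]
          have := (hΓb k).ne'
          field_simp
          ring
  have hsum := hasSum_integral_of_summable_integral_norm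
    (μ := volume.restrict (Ioc 0 t)) (F := fun k ξ => w k ξ • c k)
    (fun k => (hw k).smul_const (c k))
    (by simpa only [hnorm] using (summable_pow_div_Gamma hρ0 (by positivity)).mul_left _)
  have hcongr : ∫ ξ in Ioc 0 t, ((t - ξ) ^ (-ρ) : ℝ) •
      deriv (fun s : ℝ => mittagLeffler ρ 1 (lam * ((s ^ ρ : ℝ) : ℂ))) ξ
      = ∫ ξ in Ioc 0 t, ∑' k, w k ξ • c k := by
    refine setIntegral_congr_fun measurableSet_Ioc fun ξ hξ => ?_
    simp only [deriv_mittagLeffler_mul_rpow hρ0 lam hξ.1, w, mul_smul, c]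
    rw [tsum_const_smul'']
  rw [caputoDeriv, intervalIntegral.integral_of_le ht.le, hcongr, ← hsum.tsum_eq,
    ← tsum_const_smul'', mittagLeffler, ← tsum_mul_left]
  refine tsum_congr fun k => ?_
  rw [_root_.integral_smul_const, hwI, Complex.real_smul, Complex.real_smul,
    show (ρ : ℂ) * k + 1 = ((ρ * k + 1 : ℝ) : ℂ) by push_cast; rfl, Complex.Gamma_ofReal]
  have h1 : (Real.Gamma (1 - ρ) : ℂ) ≠ 0 := by exact_mod_cast hΓa.ne'
  have h2 : (Real.Gamma (ρ * (k + 1)) : ℂ) ≠ 0 := by exact_mod_cast (hΓb k).ne'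
  have h3 : (Real.Gamma (ρ * k + 1) : ℂ) ≠ 0 := by exact_mod_cast (hΓ k).ne'
  simp only [c]
  push_cast
  field_simp
  ring
end

section
/- Let 0 < ρ < 1, μ ∈ ℂ, α > 0, and let (λ_k)_{k≥1} be a nondecreasing sequence of positive reals tending to +∞ with λ_k ≠ α² for all k. Set s_k = √(α² − λ_k) (principal complex square root), μ_k^∓ = α ∓ s_k, r_k = 1/s_k. Then there exists a constant C > 0 (depending only on ρ, μ, α and (λ_k)) such that for either choice of sign, for all t ≥ 0 and all complex sequences (g_k) with ∑_k λ_k |g_k|² < ∞: ∑_k | λ_k r_k E_{ρ,μ}(−μ_k^∓ t^ρ) g_k |² ≤ C ∑_k λ_k |g_k|². -/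
/-- `s_k = √(α² − λ_k)`, the principal complex square root. -/
noncomputable def sqrtBranch (α lamk : ℝ) : ℂ := ((α ^ 2 - lamk : ℝ) : ℂ) ^ (1 / 2 : ℂ)

/-- `μ_k^∓ = α ∓ s_k`; `σ = -1` gives `μ_k^-` and `σ = 1` gives `μ_k^+`. -/
noncomputable def muk (α : ℝ) (σ : ℂ) (lamk : ℝ) : ℂ := (α : ℂ) + σ * sqrtBranch α lamk

open MeasureTheory Set Filter Topology

lemma integrableOn_cpow_mul_exp_neg {a : ℂ} (ha : 0 < a.re) {r : ℂ} (hr : 0 < r.re) :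
    IntegrableOn (fun t : ℝ => (t : ℂ) ^ (a - 1) * Complex.exp (-(r * t))) (Ioi 0) := by
  have h := integrableOn_rpow_mul_exp_neg_mul_rpow (s := a.re - 1) (p := 1) (b := r.re)
    (by linarith) one_pos hr
  refine Integrable.mono' h ?_ ?_
  · refine ContinuousOn.aestronglyMeasurable ?_ measurableSet_Ioi
    refine ContinuousOn.mul ?_ (by fun_prop)
    intro t ht
    exact (Complex.continuousAt_ofReal_cpow_const t (a - 1) (Or.inr ht.ne')).continuousWithinAt
  · refine (ae_restrict_mem measurableSet_Ioi).mono fun t ht => ?_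
    rw [norm_mul, Complex.norm_cpow_eq_rpow_re_of_pos ht, Complex.norm_exp]
    simp

/-- The Gamma integral along a ray: `∫₀^∞ t^(a-1) e^(-rt) dt = r^(-a) Γ(a)` for `Re r > 0`. -/
lemma integral_cpow_mul_exp_neg_mul_Ioi_complex {a : ℂ} (ha : 0 < a.re) {r : ℂ} (hr : 0 < r.re) :
    ∫ t : ℝ in Ioi 0, (t : ℂ) ^ (a - 1) * Complex.exp (-(r * t)) =
      r ^ (-a) * Complex.Gamma a := by
  set U : Set ℂ := {z | 0 < z.re} with hU
  have hUo : IsOpen U := isOpen_lt continuous_const Complex.continuous_re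
  have hJ : DifferentiableOn ℂ
      (fun r : ℂ => ∫ t : ℝ in Ioi 0, (t : ℂ) ^ (a - 1) * Complex.exp (-(r * t))) U := by
    intro r₀ hr₀
    have hr₀' : 0 < r₀.re := hr₀
    have hb := integrableOn_cpow_mul_exp_neg (a := a + 1) (r := ((r₀.re / 2 : ℝ) : ℂ))
      (by simpa using by linarith) (by rw [Complex.ofReal_re]; linarith)
    have hs : {z : ℂ | r₀.re / 2 < z.re} ∈ 𝓝 r₀ :=
      (isOpen_lt continuous_const Complex.continuous_re).mem_nhds
        (show r₀.re / 2 < r₀.re by linarith)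
    have key := hasDerivAt_integral_of_dominated_loc_of_deriv_le (μ := volume.restrict (Ioi 0))
      (F := fun (r : ℂ) (t : ℝ) => (t : ℂ) ^ (a - 1) * Complex.exp (-(r * t)))
      (F' := fun (r : ℂ) (t : ℝ) => -((t : ℂ) ^ (a + 1 - 1) * Complex.exp (-(r * t)))) (x₀ := r₀)
      hs ?_ (integrableOn_cpow_mul_exp_neg ha hr₀)
      (integrableOn_cpow_mul_exp_neg (a := a + 1) (by simpa using by linarith) hr₀).neg.1
      ?_ hb.norm ?_
    · exact key.2.differentiableAt.differentiableWithinAt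
    · filter_upwards [hUo.mem_nhds hr₀] with z hz
      exact (integrableOn_cpow_mul_exp_neg ha hz).1
    · refine (ae_restrict_mem measurableSet_Ioi).mono fun t ht z hz => ?_
      rw [norm_neg, norm_mul, norm_mul, Complex.norm_exp, Complex.norm_exp]
      have ht' : 0 < t := ht
      have hz' : r₀.re / 2 < z.re := hz
      refine mul_le_mul_of_nonneg_left (Real.exp_le_exp.2 ?_) (norm_nonneg _)
      simp only [Complex.neg_re, Complex.mul_re, Complex.ofReal_re, Complex.ofReal_im]
      nlinarith
    · refine (ae_restrict_mem measurableSet_Ioi).mono fun t ht z hz => ?_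
      have h1 : HasDerivAt (fun x : ℂ => Complex.exp (-(x * t)))
          (Complex.exp (-(z * t)) * (-(1 * t))) z :=
        (((hasDerivAt_id z).mul_const (t : ℂ)).neg).cexp
      convert! h1.const_mul ((t : ℂ) ^ (a - 1)) using 1
      have ht0 : (t : ℂ) ≠ 0 := by exact_mod_cast (ne_of_gt ht)
      have : (t : ℂ) ^ (a + 1 - 1) = t ^ (a - 1) * t := by
        rw [add_sub_right_comm, Complex.cpow_add _ _ ht0, Complex.cpow_one]
      rw [this]; ring
  have hG : DifferentiableOn ℂ (fun r : ℂ => r ^ (-a) * Complex.Gamma a) U := by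
    intro z hz
    exact (((hasDerivAt_id z).cpow_const (Or.inl hz)).differentiableAt.mul_const
      _).differentiableWithinAt
  have hpre : IsPreconnected U := (convex_halfSpace_re_gt 0).isPreconnected
  refine AnalyticOnNhd.eqOn_of_preconnected_of_frequently_eq (hJ.analyticOnNhd hUo)
    (hG.analyticOnNhd hUo) hpre (z₀ := 1) (by simp [hU]) ?_ hr
  have hten : Tendsto (fun x : ℝ => (x : ℂ)) (𝓝[>] 1) (𝓝[≠] 1) := by
    refine tendsto_nhdsWithin_iff.2 ⟨?_, ?_⟩
    · exact (Complex.continuous_ofReal.tendsto' 1 1 (by simp)).mono_left nhdsWithin_le_nhds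
    · filter_upwards [self_mem_nhdsWithin] with x hx
      simpa using (ne_of_gt hx)
  refine hten.frequently (Eventually.frequently ?_)
  filter_upwards [self_mem_nhdsWithin] with x hx
  have hx0 : (0 : ℝ) < x := lt_trans one_pos hx
  rw [Complex.integral_cpow_mul_exp_neg_mul_Ioi ha hx0, one_div, Complex.inv_cpow,
    Complex.cpow_neg]
  rw [Complex.arg_ofReal_of_nonneg hx0.le]
  exact Real.pi_ne_zero.symm

/-- The point `c + 2πξi` of the vertical line `Re s = c`. -/
noncomputable def verticalLine (c ξ : ℝ) : ℂ := c + (2 * Real.pi * ξ : ℝ) * Complex.I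

@[simp] lemma verticalLine_re (c ξ : ℝ) : (verticalLine c ξ).re = c := by
  simp [verticalLine]

@[simp] lemma verticalLine_im (c ξ : ℝ) : (verticalLine c ξ).im = 2 * Real.pi * ξ := by
  simp [verticalLine]

@[fun_prop] lemma continuous_verticalLine (c : ℝ) : Continuous (verticalLine c) := by
  unfold verticalLine; fun_prop

lemma verticalLine_ne_zero {c : ℝ} (hc : 0 < c) (ξ : ℝ) : verticalLine c ξ ≠ 0 := by
  intro h
  have := congrArg Complex.re h
  simp at this
  exact hc.ne' this

lemma le_norm_verticalLine {c : ℝ} (ξ : ℝ) : c ≤ ‖verticalLine c ξ‖ := by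
  simpa using Complex.re_le_norm (verticalLine c ξ)

lemma continuous_verticalLine_cpow {c : ℝ} (hc : 0 < c) (w : ℂ) :
    Continuous fun ξ => verticalLine c ξ ^ w := by
  refine continuous_iff_continuousAt.2 fun ξ => ?_
  exact ((continuous_verticalLine c).continuousAt).cpow continuousAt_const
    (Or.inl (by simpa using hc))

lemma norm_verticalLine_cpow_neg_le {c : ℝ} (hc : 0 < c) {w : ℂ} (hw : 2 ≤ w.re) (ξ : ℝ) :
    ‖verticalLine c ξ ^ (-w)‖ ≤
      Real.exp (Real.pi * |w.im|) * c ^ (2 - w.re) * (c ^ 2 + (2 * Real.pi * ξ) ^ 2)⁻¹ := by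
  have hn := norm_pos_iff.2 (verticalLine_ne_zero hc ξ)
  have hsq : ‖verticalLine c ξ‖ ^ 2 = c ^ 2 + (2 * Real.pi * ξ) ^ 2 := by
    rw [Complex.sq_norm, Complex.normSq_apply]; simp; ring
  rw [Complex.norm_cpow_of_ne_zero (verticalLine_ne_zero hc ξ), div_eq_mul_inv, ← Real.exp_neg,
    ← hsq]
  have h1 : ‖verticalLine c ξ‖ ^ (-w).re =
      ‖verticalLine c ξ‖ ^ (2 - w.re) * (‖verticalLine c ξ‖ ^ 2)⁻¹ := by
    rw [← Real.rpow_natCast, ← Real.rpow_neg hn.le, ← Real.rpow_add hn]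
    congr 1; rw [Complex.neg_re]; push_cast; ring
  have h2 : ‖verticalLine c ξ‖ ^ (2 - w.re) ≤ c ^ (2 - w.re) :=
    Real.rpow_le_rpow_of_nonpos hc (le_norm_verticalLine ξ) (by linarith)
  have h3 : -(Complex.arg (verticalLine c ξ) * (-w).im) ≤ Real.pi * |w.im| := by
    calc _ ≤ |(verticalLine c ξ).arg * w.im| := by
          rw [Complex.neg_im, mul_neg, neg_neg]; exact le_abs_self _
      _ ≤ _ := by rw [abs_mul]; gcongr; exact Complex.abs_arg_le_pi _
  rw [h1]
  calc _ ≤ c ^ (2 - w.re) * (‖verticalLine c ξ‖ ^ 2)⁻¹ * Real.exp (Real.pi * |w.im|) := by gcongr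
    _ = _ := by ring

lemma integrable_inv_sq_add_sq {c : ℝ} (hc : 0 < c) :
    Integrable fun ξ : ℝ => (c ^ 2 + (2 * Real.pi * ξ) ^ 2)⁻¹ := by
  have h := (integrable_inv_one_add_sq.comp_mul_left' (R := 2 * Real.pi / c)
    (by positivity)).const_mul (c ^ 2)⁻¹
  refine h.congr (Eventually.of_forall fun ξ => ?_)
  have : c ^ 2 + (2 * Real.pi * ξ) ^ 2 ≠ 0 := by positivity
  simp only
  rw [← mul_inv]; congr 1; field_simp

lemma integrable_verticalLine_cpow_neg {c : ℝ} (hc : 0 < c) {w : ℂ} (hw : 2 ≤ w.re) :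
    Integrable fun ξ => verticalLine c ξ ^ (-w) :=
  Integrable.mono' ((integrable_inv_sq_add_sq hc).const_mul _)
    (continuous_verticalLine_cpow hc _).aestronglyMeasurable
    (Eventually.of_forall (norm_verticalLine_cpow_neg_le hc hw))

lemma norm_exp_verticalLine (c ξ : ℝ) : ‖Complex.exp (verticalLine c ξ)‖ = Real.exp c := by
  simp [Complex.norm_exp]

open FourierTransform in
/-- Laplace's integral for the reciprocal Gamma function. -/
lemma integral_exp_mul_cpow_neg_eq_inv_Gamma {c : ℝ} (hc : 0 < c) {w : ℂ} (hw : 2 ≤ w.re) :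
    ∫ ξ : ℝ, Complex.exp (verticalLine c ξ) * verticalLine c ξ ^ (-w) =
      (Complex.Gamma w)⁻¹ := by
  have hw0 : 0 < w.re := by linarith
  set f : ℝ → ℂ := (Ioi (0 : ℝ)).indicator
    fun t => (t : ℂ) ^ (w - 1) * Complex.exp (-((c : ℂ) * t)) with hf
  have hfi : Integrable f :=
    (integrable_indicator_iff measurableSet_Ioi).2
      (integrableOn_cpow_mul_exp_neg hw0 (by simpa using hc))
  have hF : 𝓕 f = fun ξ => verticalLine c ξ ^ (-w) * Complex.Gamma w := by
    ext ξ
    rw [Real.fourier_real_eq_integral_exp_smul,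
      ← integral_cpow_mul_exp_neg_mul_Ioi_complex hw0 (r := verticalLine c ξ) (by simpa using hc),
      ← integral_indicator measurableSet_Ioi]
    congr 1; ext t
    by_cases ht : t ∈ Ioi (0 : ℝ)
    · simp only [hf, indicator_of_mem ht, smul_eq_mul]
      rw [mul_left_comm, ← Complex.exp_add]
      congr 2
      simp [verticalLine]; ring
    · simp [hf, indicator_of_notMem ht]
  have hFi : Integrable (𝓕 f) := by
    rw [hF]; exact (integrable_verticalLine_cpow_neg hc hw).mul_const _
  have hcont : ContinuousAt f 1 := by
    have : f =ᶠ[𝓝 1] fun t => (t : ℂ) ^ (w - 1) * Complex.exp (-((c : ℂ) * t)) := by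
      filter_upwards [Ioi_mem_nhds (zero_lt_one' ℝ)] with t ht
      exact indicator_of_mem ht _
    refine ContinuousAt.congr ?_ this.symm
    exact (Complex.continuousAt_ofReal_cpow_const 1 (w - 1) (Or.inr one_ne_zero)).mul
      (by fun_prop)
  have hinv := hfi.fourierInv_fourier_eq hFi hcont
  rw [hF, Real.fourierInv_eq'] at hinv
  have hf1 : f 1 = Complex.exp (-c) := by
    simp [hf]
  rw [hf1] at hinv
  rw [eq_comm, inv_eq_of_mul_eq_one_left]
  calc (∫ ξ : ℝ, Complex.exp (verticalLine c ξ) * verticalLine c ξ ^ (-w)) * Complex.Gamma w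
      = Complex.exp c * ∫ ξ : ℝ, Complex.exp (((2 * Real.pi * inner ℝ ξ (1 : ℝ) : ℝ) : ℂ)
          * Complex.I) • (verticalLine c ξ ^ (-w) * Complex.Gamma w) := by
        rw [← integral_mul_const, ← integral_const_mul]
        congr 1; ext ξ
        rw [verticalLine, Complex.exp_add]
        simp
        ring
    _ = 1 := by rw [hinv, ← Complex.exp_add]; simp

lemma norm_inv_Gamma_le {c : ℝ} (hc : 0 < c) {w : ℂ} (hw : 2 ≤ w.re) :
    ‖(Complex.Gamma w)⁻¹‖ ≤ Real.exp c * (Real.exp (Real.pi * |w.im|) * c ^ (2 - w.re) *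
      ∫ ξ : ℝ, (c ^ 2 + (2 * Real.pi * ξ) ^ 2)⁻¹) := by
  rw [← integral_exp_mul_cpow_neg_eq_inv_Gamma hc hw, ← integral_const_mul, ← integral_const_mul]
  refine norm_integral_le_of_norm_le (((integrable_inv_sq_add_sq hc).const_mul _).const_mul _)
    (Eventually.of_forall fun ξ => ?_)
  rw [norm_mul, norm_exp_verticalLine]
  gcongr
  exact norm_verticalLine_cpow_neg_le hc hw ξ

lemma summable_norm_mittagLeffler_coeff {ρ : ℝ} (hρ : 0 < ρ) (μ : ℂ) {R : ℝ} (hR : 0 < R) :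
    Summable fun k : ℕ => R ^ k * ‖(Complex.Gamma ((ρ : ℂ) * k + μ))⁻¹‖ := by
  set c : ℝ := (2 * R) ^ ρ⁻¹ with hc
  have hc0 : 0 < c := by positivity
  have hcρ : c ^ ρ = 2 * R := by
    rw [hc, ← Real.rpow_mul (by positivity), inv_mul_cancel₀ hρ.ne', Real.rpow_one]
  set M : ℝ := Real.exp c * (Real.exp (Real.pi * |μ.im|) * c ^ (2 - μ.re) *
      ∫ ξ : ℝ, (c ^ 2 + (2 * Real.pi * ξ) ^ 2)⁻¹) with hM
  refine Summable.of_norm_bounded_eventually_nat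
    (summable_geometric_two.mul_left M) ?_
  have hten : Tendsto (fun k : ℕ => ρ * (k : ℝ) + μ.re) atTop atTop :=
    tendsto_atTop_add_const_right _ _ (tendsto_natCast_atTop_atTop.const_mul_atTop hρ)
  filter_upwards [hten.eventually_ge_atTop 2] with k hk
  have hre : ((ρ : ℂ) * k + μ).re = ρ * k + μ.re := by simp
  have him : ((ρ : ℂ) * k + μ).im = μ.im := by simp
  have h := norm_inv_Gamma_le hc0 (w := (ρ : ℂ) * k + μ) (by rw [hre]; exact hk)
  rw [hre, him] at h
  have hpow : c ^ (2 - (ρ * k + μ.re)) = c ^ (2 - μ.re) * ((2 * R) ^ k)⁻¹ := by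
    rw [← hcρ, ← Real.rpow_natCast, ← Real.rpow_mul hc0.le, ← Real.rpow_neg hc0.le,
      ← Real.rpow_add hc0]
    congr 1; ring
  rw [Real.norm_of_nonneg (by positivity)]
  calc _ ≤ R ^ k * _ := mul_le_mul_of_nonneg_left h (by positivity)
    _ = M * (1 / 2) ^ k := by
      rw [hpow, hM, mul_pow, one_div, inv_pow]
      field_simp

lemma norm_mittagLeffler_term_le {ρ R : ℝ} {μ z : ℂ} (hz : ‖z‖ ≤ R) (k : ℕ) :
    ‖z ^ k / Complex.Gamma ((ρ : ℂ) * k + μ)‖ ≤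
      R ^ k * ‖(Complex.Gamma ((ρ : ℂ) * k + μ))⁻¹‖ := by
  rw [div_eq_mul_inv, norm_mul, norm_pow]
  gcongr

lemma summable_mittagLeffler {ρ : ℝ} (hρ : 0 < ρ) (μ z : ℂ) :
    Summable fun k : ℕ => z ^ k / Complex.Gamma ((ρ : ℂ) * k + μ) :=
  Summable.of_norm_bounded (summable_norm_mittagLeffler_coeff hρ μ (R := ‖z‖ + 1) (by positivity))
    (norm_mittagLeffler_term_le (by linarith))

lemma differentiable_mittagLeffler {ρ : ℝ} (hρ : 0 < ρ) (μ : ℂ) :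
    Differentiable ℂ (mittagLeffler ρ μ) := by
  intro z
  have h := Complex.differentiableOn_tsum_of_summable_norm
    (summable_norm_mittagLeffler_coeff hρ μ (R := ‖z‖ + 1) (by positivity))
    (F := fun (k : ℕ) w => w ^ k / Complex.Gamma ((ρ : ℂ) * k + μ)) (U := Metric.ball 0 (‖z‖ + 1))
    (fun k => ((differentiable_fun_id.pow k).div_const _).differentiableOn) Metric.isOpen_ball
    (fun k w hw => norm_mittagLeffler_term_le (mem_ball_zero_iff.1 hw).le k)
  exact h.differentiableAt (Metric.isOpen_ball.mem_nhds (by simp))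

/-- The relation `(μ - 1) E_{ρ,μ}(z) + ρ z E_{ρ,μ}'(z) = E_{ρ,μ-1}(z)`. -/
lemma mittagLeffler_sub_one {ρ : ℝ} (hρ : 0 < ρ) (μ z : ℂ) :
    mittagLeffler ρ (μ - 1) z =
      (μ - 1) * mittagLeffler ρ μ z + ρ * (z * deriv (mittagLeffler ρ μ) z) := by
  have hd := Complex.hasSum_deriv_of_summable_norm
    (summable_norm_mittagLeffler_coeff hρ μ (R := ‖z‖ + 1) (by positivity))
    (F := fun (k : ℕ) w => w ^ k / Complex.Gamma ((ρ : ℂ) * k + μ)) (U := Metric.ball 0 (‖z‖ + 1))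
    (z := z)
    (fun k => ((differentiable_fun_id.pow k).div_const _).differentiableOn) Metric.isOpen_ball
    (fun k w hw => norm_mittagLeffler_term_le (mem_ball_zero_iff.1 hw).le k) (by simp)
  have hs := (summable_mittagLeffler hρ μ z).hasSum.mul_left (μ - 1)
  refine HasSum.tsum_eq ?_
  convert! hs.add ((hd.mul_left z).mul_left (ρ : ℂ)) using 1
  ext k
  have hG := Complex.one_div_Gamma_eq_self_mul_one_div_Gamma_add_one ((ρ : ℂ) * k + (μ - 1))
  rw [show (ρ : ℂ) * k + (μ - 1) + 1 = ρ * k + μ by ring] at hG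
  have hder : z * deriv (fun w => w ^ k / Complex.Gamma ((ρ : ℂ) * k + μ)) z =
      k * (z ^ k / Complex.Gamma ((ρ : ℂ) * k + μ)) := by
    rw [deriv_div_const, deriv_pow_field]
    rcases k with _ | k
    · simp
    · rw [Nat.add_sub_cancel, pow_succ]; ring
  rw [hder, div_eq_mul_inv, hG, div_eq_mul_inv]
  ring

/-- A neighbourhood of the origin together with the sector `Re z ≤ δ |z|`. -/
def leftRegion (δ : ℝ) : Set ℂ := {z | z.re < δ * (‖z‖ + 1)}

lemma isOpen_leftRegion (δ : ℝ) : IsOpen (leftRegion δ) :=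
  isOpen_lt Complex.continuous_re (by fun_prop)

lemma zero_mem_leftRegion {δ : ℝ} (hδ : 0 < δ) : (0 : ℂ) ∈ leftRegion δ := by
  simpa [leftRegion] using hδ

lemma isPreconnected_leftRegion {δ : ℝ} (hδ : 0 < δ) : IsPreconnected (leftRegion δ) := by
  have : StarConvex ℝ (0 : ℂ) (leftRegion δ) := by
    refine starConvex_zero_iff.2 fun z hz t ht0 ht1 => ?_
    simp only [leftRegion, mem_ofPred_eq, Complex.real_smul, norm_mul,
      Complex.re_ofReal_mul, Complex.norm_real, Real.norm_of_nonneg ht0] at hz ⊢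
    rcases ht0.eq_or_lt with rfl | h0
    · simpa using hδ
    · nlinarith [mul_lt_mul_of_pos_left hz h0]
  exact (this.isPathConnected (zero_mem_leftRegion hδ)).isConnected.isPreconnected

lemma le_norm_sub_of_mem_leftRegion {c₀ : ℝ} (h0 : 0 < c₀) (h1 : c₀ ≤ 1) {q z : ℂ}
    (hq1 : 1 ≤ ‖q‖) (hq : c₀ * ‖q‖ ≤ q.re) (hz : z ∈ leftRegion (c₀ / 6)) :
    c₀ / 2 * ‖q‖ ≤ ‖q - z‖ := by
  simp only [leftRegion, mem_ofPred_eq] at hz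
  rcases le_total (2 * ‖q‖) ‖z‖ with h | h
  · have := norm_sub_norm_le z q
    rw [norm_sub_rev] at this
    nlinarith
  · have := Complex.re_le_norm (q - z)
    rw [Complex.sub_re] at this
    nlinarith

lemma cos_mul_norm_cpow_le_re {s : ℂ} (hs : 0 < s.re) {ρ : ℝ} (h0 : 0 ≤ ρ) (h1 : ρ ≤ 1) :
    Real.cos (ρ * (Real.pi / 2)) * ‖s ^ (ρ : ℂ)‖ ≤ (s ^ (ρ : ℂ)).re := by
  have hs0 : s ≠ 0 := by rintro rfl; simp at hs
  have harg : |s.arg| < Real.pi / 2 := Complex.abs_arg_lt_pi_div_two_iff.2 (Or.inl hs)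
  rw [Complex.cpow_def_of_ne_zero hs0, Complex.norm_exp, Complex.exp_re, mul_comm]
  gcongr
  have : (Complex.log s * ρ).im = ρ * s.arg := by
    rw [mul_comm, Complex.im_ofReal_mul, Complex.log_im]
  rw [this, ← Real.cos_abs (ρ * s.arg), abs_mul, abs_of_nonneg h0]
  refine Real.cos_le_cos_of_nonneg_of_le_pi (by positivity) ?_ (by gcongr)
  nlinarith [Real.pi_pos]

/-- If `Re μ ≥ 2`, then `E_{ρ,μ}` is bounded in a sector slightly larger than the left
half-plane. -/
lemma exists_bound_mittagLeffler_of_two_le {ρ : ℝ} (hρ0 : 0 < ρ) (hρ1 : ρ < 1) {μ : ℂ}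
    (hμ : 2 ≤ μ.re) :
    ∃ δ, 0 < δ ∧ δ ≤ 1 ∧ ∃ C, ∀ z ∈ leftRegion δ, ‖mittagLeffler ρ μ z‖ ≤ C := by
  set c₀ : ℝ := Real.cos (ρ * (Real.pi / 2)) with hc₀
  have hc0 : 0 < c₀ :=
    Real.cos_pos_of_mem_Ioo ⟨by nlinarith [Real.pi_pos], by nlinarith [Real.pi_pos]⟩
  have hc1 : c₀ ≤ 1 := Real.cos_le_one _
  set q : ℝ → ℂ := fun ξ => verticalLine 1 ξ ^ (ρ : ℂ) with hq
  have hqc : Continuous q := continuous_verticalLine_cpow one_pos _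
  have hq1 : ∀ ξ, 1 ≤ ‖q ξ‖ := fun ξ => by
    rw [hq, Complex.norm_cpow_real]
    exact Real.one_le_rpow (le_norm_verticalLine ξ) hρ0.le
  have hq0 : ∀ ξ, q ξ ≠ 0 := fun ξ => norm_pos_iff.1 (one_pos.trans_le (hq1 ξ))
  have hqre : ∀ ξ, c₀ * ‖q ξ‖ ≤ (q ξ).re := fun ξ =>
    cos_mul_norm_cpow_le_re (by simp) hρ0.le hρ1.le
  have hsep : ∀ ξ, ∀ z ∈ leftRegion (c₀ / 6), c₀ / 2 * ‖q ξ‖ ≤ ‖q ξ - z‖ := fun ξ z hz =>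
    le_norm_sub_of_mem_leftRegion hc0 hc1 (hq1 ξ) (hqre ξ) hz
  have hsub : ∀ ξ, ∀ z ∈ leftRegion (c₀ / 6), 0 < ‖q ξ - z‖ := fun ξ z hz =>
    lt_of_lt_of_le (by have := hq1 ξ; positivity) (hsep ξ z hz)
  have hsub0 : ∀ ξ, ∀ z ∈ leftRegion (c₀ / 6), q ξ - z ≠ 0 := fun ξ z hz =>
    norm_pos_iff.1 (hsub ξ z hz)
  set h : ℝ → ℂ := fun ξ => Complex.exp (verticalLine 1 ξ) * verticalLine 1 ξ ^ (-μ) with hh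
  have hhc : Continuous h := (by fun_prop : Continuous fun ξ =>
    Complex.exp (verticalLine 1 ξ)).mul (continuous_verticalLine_cpow one_pos _)
  have hhi : Integrable h := by
    refine ((integrable_verticalLine_cpow_neg one_pos hμ).norm.const_mul (Real.exp 1)).mono'
      hhc.aestronglyMeasurable (Eventually.of_forall fun ξ => ?_)
    rw [norm_mul, norm_exp_verticalLine]
  set F : ℂ → ℝ → ℂ := fun z ξ => h ξ * (q ξ / (q ξ - z)) with hF
  have hFc : ∀ z ∈ leftRegion (c₀ / 6), Continuous (F z) := fun z hz =>
    hhc.mul (hqc.div (hqc.sub continuous_const) fun ξ => hsub0 ξ z hz)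
  have hratio : ∀ ξ, ∀ z ∈ leftRegion (c₀ / 6), ‖q ξ / (q ξ - z)‖ ≤ 2 / c₀ := fun ξ z hz => by
    rw [norm_div, div_le_div_iff₀ (hsub ξ z hz) hc0]
    linarith [hsep ξ z hz]
  have hFb : ∀ z ∈ leftRegion (c₀ / 6), ∀ ξ, ‖F z ξ‖ ≤ ‖h ξ‖ * (2 / c₀) := fun z hz ξ => by
    rw [hF, norm_mul]; gcongr; exact hratio ξ z hz
  have hFi : ∀ z ∈ leftRegion (c₀ / 6), Integrable (F z) := fun z hz =>
    (hhi.norm.mul_const _).mono' (hFc z hz).aestronglyMeasurable (Eventually.of_forall (hFb z hz))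
  have hdiff : DifferentiableOn ℂ (fun z => ∫ ξ, F z ξ) (leftRegion (c₀ / 6)) := by
    intro z₀ hz₀
    have hs := (isOpen_leftRegion (c₀ / 6)).mem_nhds hz₀
    have key := hasDerivAt_integral_of_dominated_loc_of_deriv_le (μ := volume) (F := F)
      (F' := fun z ξ => h ξ * (q ξ / (q ξ - z) ^ 2)) (x₀ := z₀)
      (bound := fun ξ => ‖h ξ‖ * (2 / c₀ * (2 / c₀))) hs
      (by filter_upwards [hs] with z hz using (hFc z hz).aestronglyMeasurable) (hFi z₀ hz₀)
      (hhc.mul (hqc.div ((hqc.sub continuous_const).pow 2)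
        fun ξ => pow_ne_zero 2 (hsub0 ξ z₀ hz₀))).aestronglyMeasurable ?_
      (hhi.norm.mul_const _) ?_
    · exact key.2.differentiableAt.differentiableWithinAt
    · refine Eventually.of_forall fun ξ z hz => ?_
      have hinv : ‖(q ξ - z)⁻¹‖ ≤ 2 / c₀ := by
        rw [norm_inv, inv_le_comm₀ (hsub ξ z hz) (by positivity), inv_div]
        nlinarith [hsep ξ z hz, hq1 ξ]
      rw [norm_mul, pow_two, ← div_div, div_eq_mul_inv _ (q ξ - z), norm_mul (q ξ / (q ξ - z))]
      gcongr
      exact hratio ξ z hz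
    · refine Eventually.of_forall fun ξ z hz => ?_
      have h1 : HasDerivAt (fun z => (q ξ - z)⁻¹) (-(-1) / (q ξ - z) ^ 2) z :=
        ((hasDerivAt_id z).const_sub (q ξ)).inv (hsub0 ξ z hz)
      convert! (h1.const_mul (q ξ)).const_mul (h ξ) using 1
      ring
  have hball : ∀ z ∈ leftRegion (c₀ / 6), ‖z‖ < 1 → mittagLeffler ρ μ z = ∫ ξ, F z ξ := by
    intro z hz hz1
    have hterm : ∀ (k : ℕ) ξ, h ξ * (z / q ξ) ^ k =
        z ^ k * (Complex.exp (verticalLine 1 ξ) * verticalLine 1 ξ ^ (-((ρ : ℂ) * k + μ))) := by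
      intro k ξ
      have : verticalLine 1 ξ ^ (-((ρ : ℂ) * k + μ)) =
          (q ξ ^ k)⁻¹ * verticalLine 1 ξ ^ (-μ) := by
        rw [neg_add, Complex.cpow_add _ _ (verticalLine_ne_zero one_pos ξ), Complex.cpow_neg,
          Complex.cpow_mul_nat]
      rw [this, hh, div_pow]; ring
    have hnorm : ∀ (k : ℕ) ξ, ‖h ξ * (z / q ξ) ^ k‖ ≤ ‖z‖ ^ k * ‖h ξ‖ := by
      intro k ξ
      rw [norm_mul, norm_pow, norm_div, mul_comm]
      gcongr
      exact div_le_self (norm_nonneg _) (hq1 ξ)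
    have hint : ∀ k : ℕ, Integrable fun ξ => h ξ * (z / q ξ) ^ k := fun k =>
      (hhi.norm.const_mul _).mono'
        (hhc.mul ((continuous_const.div hqc hq0).pow k)).aestronglyMeasurable
        (Eventually.of_forall (hnorm k))
    have hsum := hasSum_integral_of_summable_integral_norm hint (by
      refine Summable.of_nonneg_of_le (fun k => integral_nonneg fun ξ => norm_nonneg _)
        (fun k => ?_) ((summable_geometric_of_lt_one (norm_nonneg z) hz1).mul_right
          (∫ ξ, ‖h ξ‖))
      rw [← integral_const_mul]
      exact integral_mono (hint k).norm (hhi.norm.const_mul _) (hnorm k))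
    have hlhs : mittagLeffler ρ μ z = ∑' k : ℕ, ∫ ξ, h ξ * (z / q ξ) ^ k := by
      refine tsum_congr fun k => ?_
      simp_rw [hterm k]
      rw [integral_const_mul, integral_exp_mul_cpow_neg_eq_inv_Gamma one_pos, div_eq_mul_inv]
      have : 0 ≤ ρ * (k : ℝ) := by positivity
      simp only [Complex.add_re, Complex.re_ofReal_mul, Complex.natCast_re]
      linarith
    rw [hlhs, hsum.tsum_eq]
    congr 1; ext ξ
    have hlt : ‖z / q ξ‖ < 1 := by
      rw [norm_div]; exact (div_le_self (norm_nonneg _) (hq1 ξ)).trans_lt hz1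
    rw [tsum_mul_left, tsum_geometric_of_norm_lt_one hlt, hF]
    have := hsub0 ξ z hz
    have := hq0 ξ
    congr 1
    rw [one_sub_div this, inv_div]
  have hU := isOpen_leftRegion (c₀ / 6)
  have h0U := zero_mem_leftRegion (δ := c₀ / 6) (by positivity)
  have heq : EqOn (mittagLeffler ρ μ) (fun z => ∫ ξ, F z ξ) (leftRegion (c₀ / 6)) := by
    refine AnalyticOnNhd.eqOn_of_preconnected_of_eventuallyEq
      ((differentiable_mittagLeffler hρ0 μ).differentiableOn.analyticOnNhd hU)
      (hdiff.analyticOnNhd hU) (isPreconnected_leftRegion (by positivity)) h0U ?_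
    filter_upwards [hU.mem_nhds h0U, Metric.ball_mem_nhds (0 : ℂ) one_pos] with z hz hz1
    exact hball z hz (by simpa using hz1)
  refine ⟨c₀ / 6, by positivity, by linarith, ∫ ξ, ‖h ξ‖ * (2 / c₀), fun z hz => ?_⟩
  rw [heq hz]
  exact norm_integral_le_of_norm_le (hhi.norm.mul_const _) (Eventually.of_forall (hFb z hz))

lemma exists_bound_mittagLeffler_sub_one {ρ : ℝ} (hρ : 0 < ρ) {μ : ℂ}
    (h : ∃ δ, 0 < δ ∧ δ ≤ 1 ∧ ∃ C, ∀ z ∈ leftRegion δ, ‖mittagLeffler ρ μ z‖ ≤ C) :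
    ∃ δ, 0 < δ ∧ δ ≤ 1 ∧ ∃ C, ∀ z ∈ leftRegion δ, ‖mittagLeffler ρ (μ - 1) z‖ ≤ C := by
  obtain ⟨δ, h0, h1, C, hC⟩ := h
  have hCpos : 0 ≤ C := (norm_nonneg _).trans (hC 0 (zero_mem_leftRegion h0))
  refine ⟨δ / 4, by positivity, by linarith, ‖μ - 1‖ * C + ρ * (C / (δ / 4)), fun z hz => ?_⟩
  simp only [leftRegion, mem_ofPred_eq] at hz hC
  have hzC : ‖mittagLeffler ρ μ z‖ ≤ C := hC z (by nlinarith [norm_nonneg z])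
  have hder : ‖z * deriv (mittagLeffler ρ μ) z‖ ≤ C / (δ / 4) := by
    rcases eq_or_ne z 0 with rfl | hz0
    · simpa using by positivity
    have hzn := norm_pos_iff.2 hz0
    have hd := Complex.norm_deriv_le_of_forall_mem_sphere_norm_le (c := z) (R := δ / 4 * ‖z‖)
      (C := C) (by positivity) (differentiable_mittagLeffler hρ μ).diffContOnCl (fun w hw => by
        have hw' : ‖w - z‖ = δ / 4 * ‖z‖ := mem_sphere_iff_norm.1 hw
        have a1 := Complex.re_le_norm (w - z)
        rw [Complex.sub_re] at a1
        have a2 := norm_sub_norm_le z w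
        rw [norm_sub_rev] at a2
        refine hC w ?_
        have a3 : δ * ‖w‖ ≥ δ * (‖z‖ - δ / 4 * ‖z‖) := by gcongr; linarith
        nlinarith [mul_pos h0 hzn])
    rw [norm_mul]
    calc ‖z‖ * ‖deriv (mittagLeffler ρ μ) z‖ ≤ ‖z‖ * (C / (δ / 4 * ‖z‖)) := by gcongr
      _ = _ := by field_simp
  rw [mittagLeffler_sub_one hρ]
  refine (norm_add_le _ _).trans ?_
  rw [norm_mul, norm_mul (ρ : ℂ), Complex.norm_real, Real.norm_of_nonneg hρ.le]
  gcongr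

/-- For `0 < ρ < 1`, the function `E_{ρ,μ}` is bounded on the closed left half-plane. -/
lemma exists_bound_mittagLeffler_left_halfPlane {ρ : ℝ} (hρ0 : 0 < ρ) (hρ1 : ρ < 1) (μ : ℂ) :
    ∃ C, ∀ z : ℂ, z.re ≤ 0 → ‖mittagLeffler ρ μ z‖ ≤ C := by
  have key : ∀ (m : ℕ) (μ : ℂ), 2 ≤ μ.re + m →
      ∃ δ, 0 < δ ∧ δ ≤ 1 ∧ ∃ C, ∀ z ∈ leftRegion δ, ‖mittagLeffler ρ μ z‖ ≤ C := by
    intro m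
    induction m with
    | zero => exact fun μ hμ => exists_bound_mittagLeffler_of_two_le hρ0 hρ1 (by simpa using hμ)
    | succ m ih =>
      intro μ hμ
      have := exists_bound_mittagLeffler_sub_one hρ0 (ih (μ + 1) (by
        push_cast at hμ; rw [Complex.add_re, Complex.one_re]; linarith))
      rwa [add_sub_cancel_right] at this
  obtain ⟨m, hm⟩ := exists_nat_ge (2 - μ.re)
  obtain ⟨δ, h0, -, C, hC⟩ := key m μ (by linarith)
  exact ⟨C, fun z hz => hC z (lt_of_le_of_lt hz (by positivity))⟩

lemma sqrtBranch_sq (α l : ℝ) : sqrtBranch α l ^ 2 = ((α ^ 2 - l : ℝ) : ℂ) := by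
  rw [sqrtBranch, ← Complex.cpow_mul_nat]; simp

lemma norm_sqrtBranch_sq (α l : ℝ) : ‖sqrtBranch α l‖ ^ 2 = |α ^ 2 - l| := by
  rw [← norm_pow, sqrtBranch_sq, Complex.norm_real, Real.norm_eq_abs]

lemma abs_re_sqrtBranch_le {α l : ℝ} (hα : 0 ≤ α) (hl : 0 ≤ l) : |(sqrtBranch α l).re| ≤ α := by
  have h := sqrtBranch_sq α l
  set s := sqrtBranch α l
  have hre := congrArg Complex.re h
  have him := congrArg Complex.im h
  simp only [pow_two, Complex.mul_re, Complex.mul_im, Complex.ofReal_re, Complex.ofReal_im]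
    at hre him
  rcases mul_eq_zero.1 (by linarith : s.re * s.im = 0) with h0 | h0
  · rw [h0]; simpa using hα
  · refine abs_le_of_sq_le_sq (by rw [h0] at hre; nlinarith) hα

lemma muk_re_nonneg {α l : ℝ} (hα : 0 ≤ α) (hl : 0 ≤ l) {σ : ℂ} (hσ : σ = 1 ∨ σ = -1) :
    0 ≤ (muk α σ l).re := by
  have := abs_le.1 (abs_re_sqrtBranch_le hα hl)
  rcases hσ with rfl | rfl <;> simp [muk] <;> linarith

lemma exists_bound_div_abs_sub {lam : ℕ → ℝ} (hlim : Tendsto lam atTop atTop)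
    (hpos : ∀ k, 0 < lam k) (a : ℝ) : ∃ B, ∀ k, lam k / |a - lam k| ≤ B := by
  have : BddAbove (range fun k => lam k / |a - lam k|) := by
    refine Filter.IsBoundedUnder.bddAbove_range ⟨2, ?_⟩
    rw [eventually_map]
    filter_upwards [hlim.eventually_ge_atTop (2 * |a|)] with k hk
    refine div_le_of_le_mul₀ (abs_nonneg _) zero_le_two ?_
    have := neg_le_abs (a - lam k)
    have := le_abs_self a
    have := hpos k
    linarith
  obtain ⟨B, hB⟩ := this
  exact ⟨B, fun k => hB ⟨k, rfl⟩⟩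

/-- **Lemma 3.14** (spectral form, via Parseval): with `r_k = 1/s_k`, the bound
`‖A R⁻¹ E_{ρ,μ}(-t^ρ S)g‖ ≤ C ‖g‖_{1/2}`, written as an inequality of spectral sums:
`∑_k |λ_k r_k E_{ρ,μ}(-μ_k^∓ t^ρ) g_k|² ≤ C ∑_k λ_k |g_k|²`. -/
theorem mittagLeffler_AR_spectral_bound (ρ : ℝ) (hρ0 : 0 < ρ) (hρ1 : ρ < 1) (μ : ℂ)
    (α : ℝ) (hα : 0 < α)
    (lam : ℕ → ℝ) (hmono : Monotone lam) (hpos : ∀ k, 0 < lam k)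
    (hlim : Filter.Tendsto lam Filter.atTop Filter.atTop)
    (hne : ∀ k, lam k ≠ α ^ 2) :
    ∃ C > 0, ∀ σ : ℂ, (σ = 1 ∨ σ = -1) → ∀ (t : ℝ), 0 ≤ t → ∀ g : ℕ → ℂ,
      Summable (fun k => lam k * ‖g k‖ ^ 2) →
      ∑' k, ‖(lam k : ℂ) * (sqrtBranch α (lam k))⁻¹ *
          mittagLeffler ρ μ (-(muk α σ (lam k)) * ((t ^ ρ : ℝ) : ℂ)) * g k‖ ^ 2
        ≤ C * ∑' k, lam k * ‖g k‖ ^ 2 := by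
  obtain ⟨M, hM⟩ := exists_bound_mittagLeffler_left_halfPlane hρ0 hρ1 μ
  obtain ⟨B, hB⟩ := exists_bound_div_abs_sub hlim hpos (α ^ 2)
  have hB0 : 0 ≤ B := le_trans (div_nonneg (hpos 0).le (abs_nonneg _)) (hB 0)
  refine ⟨B * M ^ 2 + 1, by positivity, fun σ hσ t ht g hg => ?_⟩
  have hterm : ∀ k, ‖(lam k : ℂ) * (sqrtBranch α (lam k))⁻¹ *
      mittagLeffler ρ μ (-(muk α σ (lam k)) * ((t ^ ρ : ℝ) : ℂ)) * g k‖ ^ 2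
        ≤ (B * M ^ 2 + 1) * (lam k * ‖g k‖ ^ 2) := by
    intro k
    have hl := hpos k
    have hre : (-(muk α σ (lam k)) * ((t ^ ρ : ℝ) : ℂ)).re ≤ 0 := by
      rw [mul_comm, Complex.re_ofReal_mul, Complex.neg_re, mul_neg, neg_nonpos]
      exact mul_nonneg (Real.rpow_nonneg ht ρ) (muk_re_nonneg hα.le hl.le hσ)
    have hE := hM _ hre
    set E := mittagLeffler ρ μ (-(muk α σ (lam k)) * ((t ^ ρ : ℝ) : ℂ))
    have hEsq : ‖E‖ ^ 2 ≤ M ^ 2 := by gcongr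
    rw [norm_mul, norm_mul, norm_mul, mul_pow, mul_pow, mul_pow, norm_inv, inv_pow,
      norm_sqrtBranch_sq, Complex.norm_real, Real.norm_of_nonneg hl.le]
    calc _ = lam k / |α ^ 2 - lam k| * ‖E‖ ^ 2 * (lam k * ‖g k‖ ^ 2) := by
          rw [div_eq_mul_inv]; ring
      _ ≤ B * M ^ 2 * (lam k * ‖g k‖ ^ 2) := by
          gcongr
          exact hB k
      _ ≤ _ := by gcongr; linarith
  rw [← tsum_mul_left]
  have hs := hg.mul_left (B * M ^ 2 + 1)
  exact (Summable.of_nonneg_of_le (fun k => sq_nonneg _) hterm hs).tsum_le_tsum hterm hs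
end
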